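/- arXiv:2109.14491 — 4 statements merged into one kernel-verified Lean document; each statement's English description precedes it below -/
import Mathlib

section
/- Let E be a finite set and L a Markov generator on E, i.e. (Lf)(η) = Σ_{ξ≠η} r(η,ξ)(f(ξ) − f(η)) with rates r(η,ξ) ≥ 0. Let ν be a probability measure on E with ν(η) > 0 for all η, and let L* denote the adjoint of L in L²(ν), i.e. Σ_η (Lf)(η) h(η) ν(η) = Σ_η f(η) (L*h)(η) ν(η) for all f, h. Let (μ_t)_{t≥0} be a family of probability measures on E solving the forward equation, i.e. for every f : E → ℝ the map t ↦ Σ_η f(η) μ_t(η) is differentiable with derivative Σ_η (Lf)(η) μ_t(η), and assume μ_t(η) > 0 for every η ∈ E and t > 0. Let (ν_t)_{t∈[0,T]} be a family of probability measures on E with ν_t(η) > 0 for all η and t, such that t ↦ ν_t(η) is continuously differentiable for each η. Set Ψ_t = dν_t/dν and f_t = dμ_t/dν. Then for every t ∈ (0,T), the function s ↦ H(μ_s|ν_s) is differentiable at t and H'(μ_t|ν_t) ≤ Σ_η (1/Ψ_t(η)) { (L*Ψ_t)(η) − ∂_t Ψ_t(η) } f_t(η) ν(η). -/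
open scoped BigOperators
open Finset Filter

noncomputable section

/-- A probability measure on a finite set, as a nonnegative function summing to one. -/
def IsProb {α : Type*} [Fintype α] (μ : α → ℝ) : Prop :=
  (∀ a, 0 ≤ μ a) ∧ ∑ a, μ a = 1

/-- Relative entropy `H(μ|ν)` of probability measures on a finite set. -/
def relEnt {α : Type*} [Fintype α] (μ ν : α → ℝ) : ℝ :=
  ∑ a, μ a * Real.log (μ a / ν a)

/-- The inequality `a (log b - log a) ≤ b - a`, for positive reals. -/
theorem mul_log_sub_log_le_sub {a b : ℝ} (ha : 0 < a) (hb : 0 < b) :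
    a * (Real.log b - Real.log a) ≤ b - a := by
  have h := Real.log_le_sub_one_of_pos (div_pos hb ha)
  rw [Real.log_div hb.ne' ha.ne'] at h
  calc a * (Real.log b - Real.log a) ≤ a * (b / a - 1) := by gcongr
    _ = b - a := by field_simp

/-- For a Markov generator `L` and a positive function `g`, `g · L (log g) ≤ L g` pointwise. -/
theorem mul_generator_log_le {E : Type*} [Fintype E] {r : E → E → ℝ}
    (hr : ∀ η ξ, η ≠ ξ → 0 ≤ r η ξ) {g : E → ℝ} (hg : ∀ η, 0 < g η) (η : E) :
    g η * ∑ ξ, r η ξ * (Real.log (g ξ) - Real.log (g η)) ≤ ∑ ξ, r η ξ * (g ξ - g η) := by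
  rw [Finset.mul_sum]
  refine Finset.sum_le_sum fun ξ _ => ?_
  by_cases h : η = ξ
  · simp [h]
  · rw [mul_left_comm]
    exact mul_le_mul_of_nonneg_left (mul_log_sub_log_le_sub (hg η) (hg ξ)) (hr η ξ h)

/-- The derivative of the relative entropy along differentiable positive families. -/
theorem hasDerivAt_relEnt {α : Type*} [Fintype α] {μ ν : ℝ → α → ℝ} {μ' ν' : α → ℝ} {t : ℝ}
    (hμ : ∀ a, HasDerivAt (fun s => μ s a) (μ' a) t)
    (hν : ∀ a, HasDerivAt (fun s => ν s a) (ν' a) t)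
    (hμ_pos : ∀ a, 0 < μ t a) (hν_pos : ∀ a, 0 < ν t a) :
    HasDerivAt (fun s => relEnt (μ s) (ν s))
      (∑ a, Real.log (μ t a / ν t a) * μ' a + ∑ a, μ' a - ∑ a, μ t a / ν t a * ν' a) t := by
  unfold relEnt
  rw [← Finset.sum_add_distrib, ← Finset.sum_sub_distrib]
  refine HasDerivAt.fun_sum fun a _ => ?_
  have hm := (hμ_pos a).ne'
  have hn := (hν_pos a).ne'
  refine ((hμ a).mul (((hμ a).div (hν a) hn).log (div_ne_zero hm hn))).congr_deriv ?_
  simp only [Pi.div_apply]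
  field_simp
  ring

/-- **Entropy production inequality** (Lemma 3.1 of the paper, Yau's inequality).
Let `L` be a Markov generator on a finite set `E` given by nonnegative jump rates `r`,
`νr` a strictly positive reference probability measure, `Lstar` the adjoint of `L` in
`L²(νr)`, `(μ_t)` a solution of the forward equation, strictly positive for `t > 0`, and
`(ν_t)` a strictly positive family, continuously differentiable in `t`. Then for
`t ∈ (0,T)` the entropy `s ↦ H(μ_s|ν_s)` is differentiable at `t` with
`H'(μ_t|ν_t) ≤ ∫ Ψ_t⁻¹ (L*Ψ_t - ∂_tΨ_t) f_t dνr`, where `Ψ_t = dν_t/dνr` and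
`f_t = dμ_t/dνr`. -/
theorem entropy_production_inequality
    {E : Type*} [Fintype E] [Nonempty E]
    (T : ℝ) (hT : 0 < T)
    -- the jump rates of the Markov generator `(Lf)(η) = Σ_ξ r(η,ξ)(f(ξ) - f(η))`
    (r : E → E → ℝ) (hr : ∀ η ξ, η ≠ ξ → 0 ≤ r η ξ)
    -- the strictly positive reference probability measure
    (νr : E → ℝ) (hνr : IsProb νr) (hνr_pos : ∀ η, 0 < νr η)
    -- the adjoint `L*` of `L` in `L²(νr)`
    (Lstar : (E → ℝ) → E → ℝ)
    (hLstar : ∀ f h : E → ℝ,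
      ∑ η, (∑ ξ, r η ξ * (f ξ - f η)) * h η * νr η = ∑ η, f η * Lstar h η * νr η)
    -- the solution `(μ_t)_{t ≥ 0}` of the forward equation, positive for `t > 0`
    (μ : ℝ → E → ℝ)
    (hμ_prob : ∀ t : ℝ, 0 ≤ t → IsProb (μ t))
    (hμ_pos : ∀ t : ℝ, 0 < t → ∀ η, 0 < μ t η)
    (hμ_kolm : ∀ f : E → ℝ, ∀ t : ℝ, 0 ≤ t →
      HasDerivWithinAt (fun s => ∑ η, f η * μ s η)
        (∑ η, (∑ ξ, r η ξ * (f ξ - f η)) * μ t η) (Set.Ici 0) t)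
    -- the time-dependent reference measures `(ν_t)_{t ∈ [0,T]}`
    (ν : ℝ → E → ℝ)
    (hν_prob : ∀ t ∈ Set.Icc (0 : ℝ) T, IsProb (ν t))
    (hν_pos : ∀ t ∈ Set.Icc (0 : ℝ) T, ∀ η, 0 < ν t η)
    (hν_C1 : ∀ η, ContDiffOn ℝ 1 (fun s => ν s η) (Set.Icc 0 T)) :
    ∀ t ∈ Set.Ioo (0 : ℝ) T,
      ∃ D : ℝ, HasDerivAt (fun s => relEnt (μ s) (ν s)) D t ∧
        D ≤ ∑ η, (ν t η / νr η)⁻¹ *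
              (Lstar (fun ξ => ν t ξ / νr ξ) η - deriv (fun s => ν s η / νr η) t) *
              (μ t η / νr η) * νr η := by
  classical
  intro t ht
  have htI : Set.Icc (0 : ℝ) T ∈ nhds t := Icc_mem_nhds ht.1 ht.2
  have hm : ∀ f : E → ℝ, HasDerivAt (fun s => ∑ η, f η * μ s η)
      (∑ η, (∑ ξ, r η ξ * (f ξ - f η)) * μ t η) t := fun f =>
    (hμ_kolm f t ht.1.le).hasDerivAt (Ici_mem_nhds ht.1)
  have hμ' : ∀ η, HasDerivAt (fun s => μ s η) (deriv (fun s => μ s η) t) t := fun η => by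
    have h := hm (Pi.single η 1)
    simp only [Pi.single_apply, ite_mul, one_mul, zero_mul, Finset.sum_ite_eq',
      Finset.mem_univ, if_true] at h
    exact h.differentiableAt.hasDerivAt
  have hν' : ∀ η, HasDerivAt (fun s => ν s η) (deriv (fun s => ν s η) t) t := fun η =>
    (((hν_C1 η).contDiffAt htI).differentiableAt one_ne_zero).hasDerivAt
  have hμt := hμ_pos t ht.1
  have hνt := hν_pos t ⟨ht.1.le, ht.2.le⟩
  -- the forward equation, tested against an arbitrary function
  have hfwd : ∀ f : E → ℝ, ∑ η, f η * deriv (fun s => μ s η) t =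
      ∑ η, (∑ ξ, r η ξ * (f ξ - f η)) * μ t η := fun f =>
    (HasDerivAt.fun_sum fun η _ => (hμ' η).const_mul (f η)).unique (hm f)
  have hmass : ∑ η, deriv (fun s => μ s η) t = 0 := by simpa using hfwd fun _ => 1
  refine ⟨_, hasDerivAt_relEnt hμ' hν' hμt hνt, ?_⟩
  rw [hmass, add_zero, hfwd fun η => Real.log (μ t η / ν t η)]
  have hrhs : ∑ η, (ν t η / νr η)⁻¹ *
      (Lstar (fun ξ => ν t ξ / νr ξ) η - deriv (fun s => ν s η / νr η) t) *
      (μ t η / νr η) * νr η =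
      ∑ η, μ t η / ν t η * Lstar (fun ξ => ν t ξ / νr ξ) η * νr η -
        ∑ η, μ t η / ν t η * deriv (fun s => ν s η) t := by
    rw [← Finset.sum_sub_distrib]
    refine Finset.sum_congr rfl fun η _ => ?_
    have h1 := (hνr_pos η).ne'
    have h2 := (hνt η).ne'
    rw [((hν' η).div_const (νr η)).deriv]
    field_simp
  rw [hrhs, ← hLstar (fun η => μ t η / ν t η) fun ξ => ν t ξ / νr ξ]
  refine sub_le_sub_right (Finset.sum_le_sum fun η _ => ?_) _
  have h1 := (hνr_pos η).ne'
  have h2 := (hνt η).ne'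
  have key := mul_le_mul_of_nonneg_right
    (mul_generator_log_le hr (g := fun η => μ t η / ν t η)
      (fun η => div_pos (hμt η) (hνt η)) η) (hνt η).le
  rw [mul_assoc _ (ν t η / νr η), div_mul_cancel₀ _ h1]
  refine le_of_eq_of_le ?_ key
  rw [mul_right_comm, div_mul_cancel₀ _ h2, mul_comm]

end
end

section
/- Let d ≥ 1, T > 0, U = (0,1)^d with boundary Γ and closure Ū; for 1 ≤ i ≤ d let Γ^{i,+} = {u ∈ Γ : u_i = 0} and Γ^{i,−} = {u ∈ Γ : u_i = 1}. Let ρ : [0,T] × Ū → ℝ be smooth, satisfy the heat equation ∂_t ρ(t,u) = Δρ(t,u) for all (t,u) ∈ (0,T] × U, and satisfy the Neumann boundary conditions: for each i and all t ∈ [0,T], ∂_{u_i}ρ(t,u) = 0 for all u ∈ Γ^{i,+} ∪ Γ^{i,−}. Then max_{(t,u) ∈ [0,T] × Ū} ρ(t,u) = max_{u ∈ Ū} ρ(0,u). -/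
open scoped BigOperators
open Finset Filter

noncomputable section

/-- The open hypercube `U = (0,1)^d`. -/
def cubeO (d : ℕ) : Set (Fin d → ℝ) := {u | ∀ i, u i ∈ Set.Ioo (0 : ℝ) 1}

/-- The closed hypercube `Ū = [0,1]^d`. -/
def cubeC (d : ℕ) : Set (Fin d → ℝ) := {u | ∀ i, u i ∈ Set.Icc (0 : ℝ) 1}

/-- The boundary `Γ = Ū \ U`. -/
def cubeB (d : ℕ) : Set (Fin d → ℝ) := cubeC d \ cubeO d

/-- `Γ^{i,+} = {u ∈ Γ : u_i = 0}`. -/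
def GammaP (d : ℕ) (i : Fin d) : Set (Fin d → ℝ) := {u | u ∈ cubeB d ∧ u i = 0}

/-- `Γ^{i,-} = {u ∈ Γ : u_i = 1}`. -/
def GammaM (d : ℕ) (i : Fin d) : Set (Fin d → ℝ) := {u | u ∈ cubeB d ∧ u i = 1}

/-- Partial derivative in the `i`-th spatial coordinate (one-sided at the boundary
of `[0,1]`). -/
def pderiv (d : ℕ) (i : Fin d) (f : (Fin d → ℝ) → ℝ) (u : Fin d → ℝ) : ℝ :=
  derivWithin (fun s => f (Function.update u i s)) (Set.Icc 0 1) (u i)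

theorem deriv_deriv_nonpos_of_isLocalMax {g : ℝ → ℝ} {a : ℝ} (h : IsLocalMax g a)
    (hc : ContinuousAt g a) : deriv (deriv g) a ≤ 0 := by
  by_contra! hpos
  have hmin := isLocalMin_of_deriv_deriv_pos hpos h.deriv_eq_zero hc
  have hconst : g =ᶠ[nhds a] fun _ => g a := by
    filter_upwards [h, hmin] with x h1 h2 using le_antisymm h1 h2
  have := hconst.deriv.deriv_eq
  simp at this
  linarith

/-- Second-order condition at an interior maximum of a quadratically perturbed function. -/
theorem derivWithin_derivWithin_le_of_isMax {f : ℝ → ℝ} {a ε : ℝ}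
    (hf : ContDiffOn ℝ (⊤ : ℕ∞) f (Set.Icc 0 1)) (ha : a ∈ Set.Ioo (0 : ℝ) 1)
    (hmax : ∀ s ∈ Set.Icc (0 : ℝ) 1,
      f s - ε * (s - 1 / 2) ^ 2 ≤ f a - ε * (a - 1 / 2) ^ 2) :
    derivWithin (fun s => derivWithin f (Set.Icc 0 1) s) (Set.Icc 0 1) a ≤ 2 * ε := by
  have hnhds : ∀ s ∈ Set.Ioo (0 : ℝ) 1, Set.Icc (0 : ℝ) 1 ∈ nhds s := fun s hs =>
    Icc_mem_nhds hs.1 hs.2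
  have hev : ∀ᶠ s in nhds a, s ∈ Set.Ioo (0 : ℝ) 1 := Ioo_mem_nhds ha.1 ha.2
  have hdiff : ∀ s ∈ Set.Ioo (0 : ℝ) 1, DifferentiableAt ℝ f s := fun s hs =>
    (hf.differentiableOn (by simp)).differentiableAt (hnhds s hs)
  have hf' : DifferentiableAt ℝ (derivWithin f (Set.Icc 0 1)) a :=
    ((hf.derivWithin (m := (⊤ : ℕ∞)) (uniqueDiffOn_Icc zero_lt_one)
      (by simp)).differentiableOn (by simp)).differentiableAt (hnhds a ha)
  have hquad : ∀ s : ℝ, HasDerivAt (fun s => ε * (s - 1 / 2) ^ 2) (2 * ε * (s - 1 / 2)) s := by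
    intro s
    have := ((((hasDerivAt_id s).sub_const (1 / 2)).pow 2).const_mul ε)
    refine this.congr_deriv ?_
    simp
    ring
  have hg' : deriv (fun s => f s - ε * (s - 1 / 2) ^ 2) =ᶠ[nhds a]
      fun s => derivWithin f (Set.Icc 0 1) s - 2 * ε * (s - 1 / 2) := by
    filter_upwards [hev] with s hs
    rw [derivWithin_of_mem_nhds (hnhds s hs)]
    exact ((hdiff s hs).hasDerivAt.sub (hquad s)).deriv
  have hlin : HasDerivAt (fun s => 2 * ε * (s - 1 / 2)) (2 * ε) a := by
    simpa only [mul_one, id] using ((hasDerivAt_id a).sub_const (1 / 2)).const_mul (2 * ε)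
  have hg'' : deriv (deriv (fun s => f s - ε * (s - 1 / 2) ^ 2)) a
      = deriv (derivWithin f (Set.Icc 0 1)) a - 2 * ε := by
    rw [hg'.deriv_eq]
    exact (hf'.hasDerivAt.sub hlin).deriv
  have hloc : IsLocalMax (fun s => f s - ε * (s - 1 / 2) ^ 2) a := by
    filter_upwards [hev] with s hs using hmax s (Set.Ioo_subset_Icc_self hs)
  have := deriv_deriv_nonpos_of_isLocalMax hloc
    ((hdiff a ha).continuousAt.sub (hquad a).continuousAt)
  rw [hg''] at this
  rw [derivWithin_of_mem_nhds (hnhds a ha)]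
  change deriv (derivWithin f (Set.Icc 0 1)) a ≤ 2 * ε
  linarith

theorem HasDerivWithinAt.nonneg_of_isMax_left {f : ℝ → ℝ} {f' a b : ℝ} (hab : a < b)
    (hf : HasDerivWithinAt f f' (Set.Icc a b) b) (hmax : ∀ s ∈ Set.Icc a b, f s ≤ f b) :
    0 ≤ f' := by
  by_contra! h
  have hl : HasDerivWithinAt f f' (Set.Iio b) b :=
    (hf.mono Set.Ico_subset_Icc_self).mono_of_mem_nhdsWithin (Ico_mem_nhdsLT hab)
  rw [hasDerivWithinAt_iff_tendsto_slope' (by simp)] at hl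
  have h1 := hl.eventually_lt_const h
  obtain ⟨s, hs, hs'⟩ := (h1.and (Ico_mem_nhdsLT hab)).exists
  have := hmax s (Set.Ico_subset_Icc_self hs')
  rw [slope_def_field] at hs
  exact absurd hs (not_lt.2 (div_nonneg_of_nonpos (by linarith) (by linarith [hs'.2])))

theorem HasDerivWithinAt.nonpos_of_isMax_right {f : ℝ → ℝ} {f' a b : ℝ} (hab : a < b)
    (hf : HasDerivWithinAt f f' (Set.Icc a b) a) (hmax : ∀ s ∈ Set.Icc a b, f s ≤ f a) :
    f' ≤ 0 := by
  by_contra! h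
  have hl : HasDerivWithinAt f f' (Set.Ioi a) a :=
    (hf.mono Set.Ioc_subset_Icc_self).mono_of_mem_nhdsWithin (Ioc_mem_nhdsGT hab)
  rw [hasDerivWithinAt_iff_tendsto_slope' (by simp)] at hl
  have h1 := hl.eventually_const_lt h
  obtain ⟨s, hs, hs'⟩ := (h1.and (Ioc_mem_nhdsGT hab)).exists
  have := hmax s (Set.Ioc_subset_Icc_self hs')
  rw [slope_def_field] at hs
  exact absurd hs (not_lt.2 (div_nonpos_of_nonpos_of_nonneg (by linarith) (by linarith [hs'.1])))

/-- A function on `[0,1]` with vanishing derivative at the endpoints attains the maximum of its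
perturbation by `-ε (s - 1/2)²` only at interior points. -/
theorem mem_Ioo_of_isMax {f : ℝ → ℝ} {a ε : ℝ} (hε : 0 < ε)
    (hf : DifferentiableOn ℝ f (Set.Icc 0 1)) (ha : a ∈ Set.Icc (0 : ℝ) 1)
    (hbc : a = 0 ∨ a = 1 → derivWithin f (Set.Icc 0 1) a = 0)
    (hmax : ∀ s ∈ Set.Icc (0 : ℝ) 1,
      f s - ε * (s - 1 / 2) ^ 2 ≤ f a - ε * (a - 1 / 2) ^ 2) :
    a ∈ Set.Ioo (0 : ℝ) 1 := by
  have hd : HasDerivWithinAt (fun s => f s - ε * (s - 1 / 2) ^ 2)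
      (derivWithin f (Set.Icc 0 1) a - 2 * ε * (a - 1 / 2)) (Set.Icc 0 1) a := by
    refine (hf a ha).hasDerivWithinAt.sub ?_
    refine (((((hasDerivAt_id a).sub_const (1 / 2)).pow 2).const_mul ε).congr_deriv
      ?_).hasDerivWithinAt
    simp
    ring
  refine ⟨lt_of_le_of_ne ha.1 ?_, lt_of_le_of_ne ha.2 ?_⟩
  · intro h
    rw [hbc (Or.inl h.symm)] at hd
    subst h
    have := hd.nonpos_of_isMax_right zero_lt_one hmax
    linarith
  · intro h
    rw [hbc (Or.inr h)] at hd
    subst h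
    have := hd.nonneg_of_isMax_left zero_lt_one hmax
    linarith

theorem isCompact_cubeC (d : ℕ) : IsCompact (cubeC d) := by
  have : cubeC d = Set.univ.pi fun _ => Set.Icc (0 : ℝ) 1 := by
    ext u
    simp only [cubeC, Set.mem_ofPred_eq, Set.mem_univ_pi]
  rw [this]
  exact isCompact_univ_pi fun _ => isCompact_Icc

theorem update_mem_cubeC {d : ℕ} {u : Fin d → ℝ} (hu : u ∈ cubeC d) (i : Fin d) {s : ℝ}
    (hs : s ∈ Set.Icc (0 : ℝ) 1) : Function.update u i s ∈ cubeC d := by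
  intro j
  by_cases h : j = i
  · subst h
    simpa using hs
  · simpa [Function.update_of_ne h] using hu j

theorem sum_update_eq {d : ℕ} (u : Fin d → ℝ) (i : Fin d) (s : ℝ) (φ : ℝ → ℝ) :
    ∑ j, φ (Function.update u i s j) = ∑ j, φ (u j) - φ (u i) + φ s := by
  rw [← Finset.add_sum_erase _ _ (Finset.mem_univ i),
    ← Finset.add_sum_erase Finset.univ (fun j => φ (u j)) (Finset.mem_univ i),
    Function.update_self]
  have : ∑ j ∈ Finset.univ.erase i, φ (Function.update u i s j)
      = ∑ j ∈ Finset.univ.erase i, φ (u j) :=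
    Finset.sum_congr rfl fun j hj => by rw [Function.update_of_ne (Finset.ne_of_mem_erase hj)]
  rw [this]
  ring

/-- Weak maximum principle for the perturbation of a Neumann heat solution. -/
theorem exists_initial_le_of_neumann {d : ℕ} {T : ℝ} (hT : 0 < T)
    {ρ : ℝ → (Fin d → ℝ) → ℝ}
    (hρ_smooth : ContDiffOn ℝ (⊤ : ℕ∞) (fun p : ℝ × (Fin d → ℝ) => ρ p.1 p.2)
      (Set.Icc 0 T ×ˢ cubeC d))
    (hheat : ∀ t ∈ Set.Ioc (0 : ℝ) T, ∀ u ∈ cubeO d,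
      HasDerivWithinAt (fun s => ρ s u)
        (∑ i, pderiv d i (pderiv d i (ρ t)) u) (Set.Ioc 0 T) t)
    (hbc : ∀ t ∈ Set.Icc (0 : ℝ) T, ∀ i : Fin d,
      ∀ u ∈ GammaP d i ∪ GammaM d i, pderiv d i (ρ t) u = 0)
    {ε : ℝ} (hε : 0 < ε) :
    ∃ v ∈ cubeC d, ∀ t ∈ Set.Icc (0 : ℝ) T, ∀ u ∈ cubeC d,
      ρ t u - ε * ∑ i, (u i - 1 / 2) ^ 2 - (2 * d + 1) * ε * t ≤ ρ 0 v := by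
  have hcont : ContinuousOn (fun p : ℝ × (Fin d → ℝ) =>
      ρ p.1 p.2 - ε * ∑ i, (p.2 i - 1 / 2) ^ 2 - (2 * d + 1) * ε * p.1)
      (Set.Icc 0 T ×ˢ cubeC d) :=
    (hρ_smooth.continuousOn.sub (by fun_prop)).sub (by fun_prop)
  have hne : (Set.Icc 0 T ×ˢ cubeC d).Nonempty :=
    ⟨(0, fun _ => 0), ⟨le_rfl, hT.le⟩, fun _ => ⟨le_rfl, zero_le_one⟩⟩
  obtain ⟨⟨t, u⟩, ⟨ht, hu⟩, hmax⟩ :=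
    (isCompact_Icc.prod (isCompact_cubeC d)).exists_isMaxOn hne hcont
  have hmax' : ∀ s ∈ Set.Icc (0 : ℝ) T, ∀ v ∈ cubeC d,
      ρ s v - ε * ∑ i, (v i - 1 / 2) ^ 2 - (2 * d + 1) * ε * s
        ≤ ρ t u - ε * ∑ i, (u i - 1 / 2) ^ 2 - (2 * d + 1) * ε * t :=
    fun s hs v hv => hmax (show (s, v) ∈ Set.Icc 0 T ×ˢ cubeC d from ⟨hs, hv⟩)
  simp only at ht hu
  rcases ht.1.eq_or_lt with h0 | h0
  · subst h0
    refine ⟨u, hu, fun s hs v hv => (hmax' s hs v hv).trans ?_⟩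
    have : 0 ≤ ε * ∑ i, (u i - 1 / 2) ^ 2 := by positivity
    linarith
  exfalso
  have hslice : ∀ i : Fin d,
      ContDiffOn ℝ (⊤ : ℕ∞) (fun s => ρ t (Function.update u i s)) (Set.Icc 0 1) := fun i =>
    hρ_smooth.comp (f := fun s : ℝ => (t, Function.update u i s))
      (contDiff_const.prodMk (contDiff_update _ u i)).contDiffOn
      fun s hs => ⟨ht, update_mem_cubeC hu i hs⟩
  have hslicemax : ∀ i : Fin d, ∀ s ∈ Set.Icc (0 : ℝ) 1,
      ρ t (Function.update u i s) - ε * (s - 1 / 2) ^ 2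
        ≤ ρ t (Function.update u i (u i)) - ε * (u i - 1 / 2) ^ 2 := by
    intro i s hs
    have h := hmax' t ht _ (update_mem_cubeC hu i hs)
    rw [sum_update_eq u i s fun x => (x - 1 / 2) ^ 2] at h
    rw [Function.update_eq_self]
    linarith
  have huO : u ∈ cubeO d := by
    by_contra hnot
    refine hnot fun i => mem_Ioo_of_isMax hε ((hslice i).differentiableOn (by simp)) (hu i)
      (fun h => ?_) (hslicemax i)
    exact hbc t ht i u (h.imp (fun h => ⟨⟨hu, hnot⟩, h⟩) fun h => ⟨⟨hu, hnot⟩, h⟩)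
  have hlap : ∑ i, pderiv d i (pderiv d i (ρ t)) u ≤ d * (2 * ε) := by
    have : ∀ i ∈ Finset.univ, pderiv d i (pderiv d i (ρ t)) u ≤ 2 * ε := fun i _ => by
      simpa only [pderiv, Function.update_idem, Function.update_self] using
        derivWithin_derivWithin_le_of_isMax (hslice i) (huO i) (hslicemax i)
    simpa using Finset.sum_le_sum this
  have htime : HasDerivWithinAt (fun s => ρ s u - (2 * d + 1) * ε * s)
      (∑ i, pderiv d i (pderiv d i (ρ t)) u - (2 * d + 1) * ε) (Set.Icc (t / 2) t) t := by
    refine ((hheat t ⟨h0, ht.2⟩ u huO).mono fun s hs => ⟨?_, ?_⟩).sub ?_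
    · linarith [hs.1]
    · exact hs.2.trans ht.2
    · simpa using ((hasDerivAt_id t).const_mul ((2 * d + 1) * ε)).hasDerivWithinAt
  have := htime.nonneg_of_isMax_left (by linarith) fun s hs => by
    have := hmax' s ⟨by linarith [hs.1], hs.2.trans ht.2⟩ u hu
    linarith
  linarith

/-- **Maximum principle, Neumann case** (Theorem 5.1 of the paper, θ > 1): a smooth solution
of the heat equation on `(0,T] × U` with zero Neumann boundary conditions attains its
maximum at time zero. -/
theorem maximum_principle_neumann
    (d : ℕ) (hd : 1 ≤ d) (T : ℝ) (hT : 0 < T)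
    (ρ : ℝ → (Fin d → ℝ) → ℝ)
    (hρ_smooth : ContDiffOn ℝ (⊤ : ℕ∞) (fun p : ℝ × (Fin d → ℝ) => ρ p.1 p.2)
      (Set.Icc 0 T ×ˢ cubeC d))
    (hheat : ∀ t ∈ Set.Ioc (0 : ℝ) T, ∀ u ∈ cubeO d,
      HasDerivWithinAt (fun s => ρ s u)
        (∑ i, pderiv d i (pderiv d i (ρ t)) u) (Set.Ioc 0 T) t)
    (hbc : ∀ t ∈ Set.Icc (0 : ℝ) T, ∀ i : Fin d,
      ∀ u ∈ GammaP d i ∪ GammaM d i, pderiv d i (ρ t) u = 0) :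
    sSup {r : ℝ | ∃ t ∈ Set.Icc (0 : ℝ) T, ∃ u ∈ cubeC d, r = ρ t u}
      = sSup {r : ℝ | ∃ u ∈ cubeC d, r = ρ 0 u} := by
  set A := {r : ℝ | ∃ t ∈ Set.Icc (0 : ℝ) T, ∃ u ∈ cubeC d, r = ρ t u}
  set B := {r : ℝ | ∃ u ∈ cubeC d, r = ρ 0 u}
  have hBA : B ⊆ A := fun r ⟨u, hu, hr⟩ => ⟨0, ⟨le_rfl, hT.le⟩, u, hu, hr⟩
  have hBne : B.Nonempty := ⟨_, fun _ => 0, fun _ => ⟨le_rfl, zero_le_one⟩, rfl⟩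
  have hAbdd : BddAbove A := by
    obtain ⟨M, hM⟩ := (isCompact_Icc.prod (isCompact_cubeC d)).bddAbove_image
      hρ_smooth.continuousOn
    refine ⟨M, ?_⟩
    rintro r ⟨t, ht, u, hu, rfl⟩
    exact hM ⟨(t, u), ⟨ht, hu⟩, rfl⟩
  refine le_antisymm (csSup_le (hBne.mono hBA) ?_) (csSup_le_csSup hAbdd hBne hBA)
  rintro r ⟨t, ht, u, hu, rfl⟩
  have hlim : Tendsto
      (fun ε : ℝ => ρ t u - ε * ∑ i, (u i - 1 / 2) ^ 2 - (2 * d + 1) * ε * t)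
      (nhdsWithin 0 (Set.Ioi 0)) (nhds (ρ t u)) := by
    have hc : Continuous
        (fun ε : ℝ => ρ t u - ε * ∑ i, (u i - 1 / 2) ^ 2 - (2 * d + 1) * ε * t) := by
      fun_prop
    simpa using (hc.tendsto 0).mono_left nhdsWithin_le_nhds
  refine le_of_tendsto hlim ?_
  filter_upwards [self_mem_nhdsWithin] with ε hε
  obtain ⟨v, hv, hle⟩ := exists_initial_le_of_neumann hT hρ_smooth hheat hbc hε
  exact (hle t ht u hu).trans (le_csSup (hAbdd.mono hBA) ⟨v, hv, rfl⟩)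

end
end

section
/- Let A be a non-empty finite set, let (p_x)_{x∈A} be numbers in (0,1), and let ν be the Bernoulli product probability measure on {0,1}^A with ν(η : η(x) = 1) = p_x. Let μ be any probability measure on {0,1}^A and G : A → ℝ any function, and write ‖G‖_∞ = max_{x∈A} |G(x)|. Then E_μ[ | (1/|A|) Σ_{x∈A} G(x)(η(x) − p_x) | ] ≤ (‖G‖_∞ + 1)² ( √( H(μ|ν)/|A| ) + 1/√|A| ). -/
open scoped BigOperators
open Finset

noncomputable section

/-- Real-valued indicator of a Boolean occupation variable. -/
def ind (b : Bool) : ℝ := if b then 1 else 0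

/-- The Bernoulli product measure on `{0,1}^α` with marginals `p`. -/
def bern {α : Type*} [Fintype α] (p : α → ℝ) (η : α → Bool) : ℝ :=
  ∏ a, if η a then p a else 1 - p a

/-- **Hoeffding's lemma** for a centred Bernoulli variable. -/
lemma bernoulli_mgf_le {q : ℝ} (hq : q ∈ Set.Ioo (0 : ℝ) 1) (t : ℝ) :
    ∑ b : Bool, (if b then q else 1 - q) * Real.exp (t * (ind b - q))
      ≤ Real.exp (t ^ 2 / 8) := by
  obtain ⟨h0, h1⟩ := hq
  let P : MeasureTheory.Measure Bool :=
    ENNReal.ofReal q • MeasureTheory.Measure.dirac true +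
      ENNReal.ofReal (1 - q) • MeasureTheory.Measure.dirac false
  have integral_P (f : Bool → ℝ) : ∫ b, f b ∂P = q * f true + (1 - q) * f false := by
    have (r : ℝ) (b : Bool) : MeasureTheory.IsFiniteMeasure
        (ENNReal.ofReal r • MeasureTheory.Measure.dirac b) :=
      MeasureTheory.Measure.smul_finite _ ENNReal.ofReal_ne_top
    rw [MeasureTheory.integral_add_measure .of_finite .of_finite]
    simp [MeasureTheory.integral_smul_measure, h0.le, h1.le]
  have : MeasureTheory.IsProbabilityMeasure P := ⟨by
    simp [P, ← ENNReal.ofReal_add h0.le (sub_nonneg.2 h1.le)]⟩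
  have hsub := ProbabilityTheory.hasSubgaussianMGF_of_mem_Icc_of_integral_eq_zero
    (μ := P) (X := fun b => ind b - q) (a := -q) (b := 1 - q)
    (measurable_of_finite _).aemeasurable
    (.of_forall fun b => by cases b <;> simp [ind])
    (by rw [integral_P]; simp [ind]; ring)
  have hmgf := hsub.mgf_le t
  rw [ProbabilityTheory.mgf, integral_P] at hmgf
  have hrhs : (((‖1 - q - -q‖₊ / 2) ^ 2 : NNReal) : ℝ) * t ^ 2 / 2 = t ^ 2 / 8 := by
    simp; ring
  rw [hrhs] at hmgf
  simpa using hmgf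

lemma bern_pos {α : Type*} [Fintype α] {p : α → ℝ} (hp : ∀ x, p x ∈ Set.Ioo (0 : ℝ) 1)
    (η : α → Bool) : 0 < bern p η :=
  Finset.prod_pos fun x _ => by
    split_ifs
    · exact (hp x).1
    · exact sub_pos.2 (hp x).2

/-- A weighted sum of centred independent Bernoulli variables is subgaussian. -/
lemma bern_mgf_le {α : Type*} [Fintype α] [DecidableEq α] {p : α → ℝ}
    (hp : ∀ x, p x ∈ Set.Ioo (0 : ℝ) 1) (G : α → ℝ) :
    ∑ η : α → Bool, bern p η * Real.exp (∑ x, G x * (ind (η x) - p x))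
      ≤ Real.exp ((∑ x, G x ^ 2) / 8) := by
  calc ∑ η : α → Bool, bern p η * Real.exp (∑ x, G x * (ind (η x) - p x))
      = ∏ x, ∑ b : Bool, (if b then p x else 1 - p x) * Real.exp (G x * (ind b - p x)) := by
        rw [Finset.prod_univ_sum, Fintype.piFinset_univ]
        simp only [bern, Real.exp_sum, Finset.prod_mul_distrib]
    _ ≤ ∏ x, Real.exp (G x ^ 2 / 8) := by
        refine Finset.prod_le_prod (fun x _ => Finset.sum_nonneg fun b _ => ?_)
          fun x _ => bernoulli_mgf_le (hp x) (G x)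
        have := (hp x).1.le
        have := sub_nonneg.2 (hp x).2.le
        split_ifs <;> positivity
    _ = Real.exp ((∑ x, G x ^ 2) / 8) := by rw [← Real.exp_sum, Finset.sum_div]

/-- The **entropy inequality** (Gibbs variational principle). -/
lemma sum_mul_le_relEnt_add {α : Type*} [Fintype α] {μ ν : α → ℝ} (hμ : IsProb μ)
    (hν : ∀ a, 0 < ν a) (f : α → ℝ) (c : ℝ) (hc : ∑ a, ν a * Real.exp (f a) ≤ Real.exp c) :
    ∑ a, μ a * f a ≤ relEnt μ ν + c := by
  have pointwise (a : α) : μ a * f a ≤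
      μ a * Real.log (μ a / ν a) + c * μ a + (ν a * Real.exp (f a) / Real.exp c - μ a) := by
    have hνa := hν a
    rcases (hμ.1 a).eq_or_lt with h | h
    · rw [← h]
      simp only [zero_mul, mul_zero, zero_add, sub_zero]
      positivity
    · have hlog := Real.log_le_sub_one_of_pos
        (show 0 < ν a * Real.exp (f a) / Real.exp c / μ a by positivity)
      rw [Real.log_div (by positivity) h.ne', Real.log_div (by positivity) (by positivity),
        Real.log_mul hνa.ne' (by positivity), Real.log_exp, Real.log_exp] at hlog
      rw [Real.log_div h.ne' hνa.ne']
      have hmul := mul_le_mul_of_nonneg_left hlog h.le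
      rw [mul_sub (μ a) (_ / μ a), mul_div_cancel₀ _ h.ne'] at hmul
      linarith
  have hsum := Finset.sum_le_sum fun a (_ : a ∈ Finset.univ) => pointwise a
  rw [Finset.sum_add_distrib, Finset.sum_add_distrib, Finset.sum_sub_distrib, ← Finset.mul_sum,
    ← Finset.sum_div, hμ.2] at hsum
  have := (div_le_one (Real.exp_pos c)).2 hc
  unfold relEnt
  linarith

/-- The entropy inequality applied to the modulus of a weighted sum of centred Bernoulli
variables. -/
lemma sum_mul_abs_le_relEnt_add {α : Type*} [Fintype α] [DecidableEq α] {p : α → ℝ}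
    (hp : ∀ x, p x ∈ Set.Ioo (0 : ℝ) 1) {μ : (α → Bool) → ℝ} (hμ : IsProb μ) (G : α → ℝ) :
    ∑ η : α → Bool, μ η * |∑ x, G x * (ind (η x) - p x)|
      ≤ relEnt μ (bern p) + (1 + (∑ x, G x ^ 2) / 8) := by
  refine sum_mul_le_relEnt_add hμ (bern_pos hp) _ _ ?_
  have hpos := bern_mgf_le hp G
  have hneg := bern_mgf_le hp (-G)
  simp only [Pi.neg_apply, neg_sq, neg_mul, Finset.sum_neg_distrib] at hneg
  calc ∑ η : α → Bool, bern p η * Real.exp |∑ x, G x * (ind (η x) - p x)|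
      ≤ ∑ η : α → Bool, (bern p η * Real.exp (∑ x, G x * (ind (η x) - p x)) +
          bern p η * Real.exp (-∑ x, G x * (ind (η x) - p x))) := by
        refine Finset.sum_le_sum fun η _ => ?_
        rw [← mul_add]
        exact mul_le_mul_of_nonneg_left (Real.exp_abs_le _) (bern_pos hp η).le
    _ ≤ 2 * Real.exp ((∑ x, G x ^ 2) / 8) := by
        rw [Finset.sum_add_distrib]
        linarith
    _ ≤ Real.exp (1 + (∑ x, G x ^ 2) / 8) := by
        rw [Real.exp_add]
        gcongr
        linarith [Real.add_one_le_exp (1 : ℝ)]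

/-- **Concentration estimate** (proof of Theorem 2.2 of the paper, via the entropy
inequality and Hoeffding's lemma): for `ν` a Bernoulli product measure with marginals
`p_x ∈ (0,1)` and `μ` any probability measure on `{0,1}^A`,
`E_μ[|A⁻¹ Σ_x G(x)(η(x)-p_x)|] ≤ (‖G‖_∞+1)²(√(H(μ|ν)/|A|) + 1/√|A|)`. -/
theorem entropy_concentration_bound
    {A : Type*} [Fintype A] [DecidableEq A] [Nonempty A]
    (p : A → ℝ) (hp : ∀ x, p x ∈ Set.Ioo (0 : ℝ) 1)
    (μ : (A → Bool) → ℝ) (hμ : IsProb μ)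
    (G : A → ℝ) :
    ∑ η : A → Bool, μ η *
        |(1 / (Fintype.card A : ℝ)) * ∑ x : A, G x * (ind (η x) - p x)|
      ≤ (Finset.univ.sup' Finset.univ_nonempty (fun x => |G x|) + 1) ^ 2 *
          (Real.sqrt (relEnt μ (bern p) / (Fintype.card A : ℝ))
            + 1 / Real.sqrt (Fintype.card A : ℝ)) := by
  set N : ℝ := (Fintype.card A : ℝ) with hN
  set g := Finset.univ.sup' Finset.univ_nonempty (fun x => |G x|)
  set H := relEnt μ (bern p)
  have hG (x : A) : |G x| ≤ g := Finset.le_sup' (fun x => |G x|) (Finset.mem_univ x)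
  have hg0 : 0 ≤ g := (abs_nonneg _).trans (hG (Classical.arbitrary A))
  have hN0 : 0 < N := by simp [hN, Fintype.card_pos]
  set r := √N
  have hr0 : 0 < r := Real.sqrt_pos.2 hN0
  have hrN : r ^ 2 = N := Real.sq_sqrt hN0.le
  set s := √H
  have hs0 : 0 ≤ s := Real.sqrt_nonneg _
  have hHs : H ≤ s ^ 2 := by
    rcases le_total 0 H with h | h
    · exact (Real.sq_sqrt h).ge
    · exact h.trans (sq_nonneg s)
  have hGsq : ∑ x, G x ^ 2 ≤ N * g ^ 2 := by
    calc ∑ x, G x ^ 2 ≤ ∑ _x : A, g ^ 2 :=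
          Finset.sum_le_sum fun x _ => sq_le_sq' (abs_le.1 (hG x)).1 (abs_le.1 (hG x)).2
      _ = N * g ^ 2 := by simp [hN]
  -- The exponential parameter nearly optimising the entropy inequality.
  set l := (s + 1) / r
  have hl0 : 0 < l := by positivity
  set E := ∑ η : A → Bool, μ η * |∑ x : A, G x * (ind (η x) - p x)|
  have hE : l * E ≤ H + (1 + l ^ 2 * (N * g ^ 2) / 8) := by
    have h := sum_mul_abs_le_relEnt_add hp hμ (fun x => l * G x)
    simp only [mul_assoc, ← Finset.mul_sum, abs_mul, abs_of_pos hl0, mul_pow,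
      mul_left_comm (μ _) l] at h
    refine h.trans ?_
    gcongr
  have hlr : l * r = s + 1 := div_mul_cancel₀ _ hr0.ne'
  have hlE : l * E ≤ l * ((g + 1) ^ 2 * l * N) := by
    have hlN : l ^ 2 * N = (s + 1) ^ 2 := by rw [← hrN, ← mul_pow, hlr]
    have h1 : l ^ 2 * (N * g ^ 2) = (s + 1) ^ 2 * g ^ 2 := by rw [← hlN]; ring
    have h2 : l * ((g + 1) ^ 2 * l * N) = (s + 1) ^ 2 * (g + 1) ^ 2 := by rw [← hlN]; ring
    rw [h1] at hE
    rw [h2]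
    nlinarith [mul_nonneg (sq_nonneg (s + 1)) hg0, mul_nonneg (sq_nonneg (s + 1)) (sq_nonneg g)]
  have hlhs : ∑ η : A → Bool, μ η * |1 / N * ∑ x : A, G x * (ind (η x) - p x)| = E / N := by
    simp only [abs_mul, abs_of_pos (one_div_pos.2 hN0), mul_left_comm (μ _), ← Finset.mul_sum]
    exact one_div_mul_eq_div _ _
  rw [hlhs, Real.sqrt_div' _ hN0.le, ← add_div, div_le_iff₀ hN0]
  exact le_of_mul_le_mul_left hlE hl0

end
end

section
/- Let d ≥ 1, ℓ ∈ ℕ, let A ⊂ ℤ^d be a non-empty finite set, and let ν be a product probability measure on {0,1}^A. For each x ∈ A let F_x : {0,1}^A → ℝ be a function that depends only on the coordinates {y ∈ A : |y−x| ≤ ℓ}, where |·| is the ℓ¹-distance on ℤ^d. Then log E_ν[ exp( Σ_{x∈A} F_x ) ] ≤ (1/(2ℓ+1)^d) Σ_{x∈A} log E_ν[ exp( (2ℓ+1)^d F_x ) ]. -/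
open scoped BigOperators
open Finset

noncomputable section

/-- ℓ¹ distance on `ℤ^d`. -/
def l1 {d : ℕ} (x y : Fin d → ℤ) : ℤ := ∑ i, |x i - y i|

theorem bern_nonneg {α : Type*} [Fintype α] {p : α → ℝ}
    (hp : ∀ a, p a ∈ Set.Icc (0 : ℝ) 1) (η : α → Bool) : 0 ≤ bern p η := by
  refine Finset.prod_nonneg fun a _ => ?_
  split_ifs
  · exact (hp a).1
  · exact sub_nonneg.2 (hp a).2

theorem sum_bern {α : Type*} [Fintype α] [DecidableEq α] (p : α → ℝ) :
    ∑ η, bern p η = 1 := by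
  have h := Finset.prod_univ_sum (fun _ : α => (Finset.univ : Finset Bool))
    (fun a b => if b then p a else 1 - p a)
  rw [Fintype.piFinset_univ] at h
  unfold bern
  rw [← h]
  simp

/-- Exchanging the coordinates in `S` between two configurations. -/
def exchange {α : Type*} (S : Set α) [DecidablePred (· ∈ S)]
    (q : (α → Bool) × (α → Bool)) : (α → Bool) × (α → Bool) :=
  (S.piecewise q.1 q.2, S.piecewise q.2 q.1)

theorem exchange_involutive {α : Type*} (S : Set α) [DecidablePred (· ∈ S)] :
    Function.Involutive (exchange S) := by
  rintro ⟨η, η'⟩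
  ext a <;> by_cases ha : a ∈ S <;> simp [exchange, ha]

theorem bern_mul_bern_exchange {α : Type*} [Fintype α] (p : α → ℝ) (S : Set α)
    [DecidablePred (· ∈ S)] (q : (α → Bool) × (α → Bool)) :
    bern p (exchange S q).1 * bern p (exchange S q).2 = bern p q.1 * bern p q.2 := by
  simp only [bern, ← Finset.prod_mul_distrib]
  refine Finset.prod_congr rfl fun a _ => ?_
  by_cases ha : a ∈ S
  · simp [exchange, ha]
  · simp [exchange, ha, mul_comm]

/-- Functions of disjoint sets of coordinates are uncorrelated under the product measure. -/
theorem sum_bern_mul_mul {α : Type*} [Fintype α] [DecidableEq α] (p : α → ℝ) {S T : Set α}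
    (hST : Disjoint S T) {g h : (α → Bool) → ℝ} (hg : DependsOn g S) (hh : DependsOn h T) :
    ∑ η, bern p η * (g η * h η) = (∑ η, bern p η * g η) * ∑ η, bern p η * h η := by
  classical
  have hg' : ∀ q : (α → Bool) × (α → Bool), g (exchange S q).1 = g q.1 := fun q =>
    hg fun a ha => by simp [exchange, ha]
  have hh' : ∀ q : (α → Bool) × (α → Bool), h (exchange S q).2 = h q.1 := fun q =>
    hh fun a ha => by simp [exchange, Set.disjoint_right.1 hST ha]
  calc ∑ η, bern p η * (g η * h η)
      = (∑ η, bern p η * (g η * h η)) * ∑ η, bern p η := by rw [sum_bern, mul_one]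
    _ = ∑ q : (α → Bool) × (α → Bool), bern p q.1 * bern p q.2 * (g q.1 * h q.1) := by
      rw [Finset.sum_mul_sum, ← Finset.univ_product_univ, Finset.sum_product]
      exact Finset.sum_congr rfl fun _ _ => Finset.sum_congr rfl fun _ _ => by ring
    _ = ∑ q : (α → Bool) × (α → Bool), bern p q.1 * bern p q.2 * (g q.1 * h q.2) := by
      rw [← Equiv.sum_comp (exchange_involutive S).toPerm
        fun q => bern p q.1 * bern p q.2 * (g q.1 * h q.2)]
      refine Finset.sum_congr rfl fun q _ => ?_
      simp only [Function.Involutive.coe_toPerm, bern_mul_bern_exchange, hg', hh']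
    _ = _ := by
      rw [Finset.sum_mul_sum, ← Finset.univ_product_univ, Finset.sum_product]
      exact Finset.sum_congr rfl fun _ _ => Finset.sum_congr rfl fun _ _ => by ring

/-- Functions of pairwise disjoint sets of coordinates are independent under the product
measure. -/
theorem sum_bern_mul_prod {α ι : Type*} [Fintype α] [DecidableEq α] (p : α → ℝ)
    (s : Finset ι) (S : ι → Set α) (hS : (s : Set ι).PairwiseDisjoint S)
    (g : ι → (α → Bool) → ℝ) (hg : ∀ i ∈ s, DependsOn (g i) (S i)) :
    ∑ η, bern p η * ∏ i ∈ s, g i η = ∏ i ∈ s, ∑ η, bern p η * g i η := by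
  classical
  induction s using Finset.induction_on with
  | empty => simp [sum_bern]
  | insert i s hi ih =>
    have hdisj : Disjoint (S i) (⋃ j ∈ s, S j) := by
      refine Set.disjoint_iUnion₂_right.2 fun j hj => hS (by simp) (by simp [hj]) ?_
      rintro rfl
      exact hi hj
    have hdep : DependsOn (fun η => ∏ j ∈ s, g j η) (⋃ j ∈ s, S j) := fun η η' h =>
      Finset.prod_congr rfl fun j hj => hg j (Finset.mem_insert_of_mem hj) fun a ha =>
        h a (Set.mem_biUnion hj ha)
    simp only [Finset.prod_insert hi]
    rw [sum_bern_mul_mul p hdisj (hg i (Finset.mem_insert_self i s)) hdep,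
      ih (hS.subset (by simp)) fun j hj => hg j (Finset.mem_insert_of_mem hj)]

theorem sum_mul_exp_pos {Ω : Type*} [Fintype Ω] {w : Ω → ℝ} (hw : ∀ ω, 0 ≤ w ω)
    (hw1 : ∑ ω, w ω = 1) (f : Ω → ℝ) : 0 < ∑ ω, w ω * Real.exp (f ω) := by
  obtain ⟨ω, -, hω⟩ := Finset.exists_ne_zero_of_sum_ne_zero (hw1 ▸ one_ne_zero)
  exact Finset.sum_pos' (fun ω _ => mul_nonneg (hw ω) (Real.exp_pos _).le)
    ⟨ω, Finset.mem_univ _, mul_pos (lt_of_le_of_ne (hw ω) hω.symm) (Real.exp_pos _)⟩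

/-- Hölder's inequality with equal exponents, in logarithmic form. -/
theorem log_sum_mul_exp_sum_le {Ω ι : Type*} [Fintype Ω] [Fintype ι] [Nonempty ι]
    {w : Ω → ℝ} (hw : ∀ ω, 0 ≤ w ω) (hw1 : ∑ ω, w ω = 1) (f : ι → Ω → ℝ) :
    Real.log (∑ ω, w ω * Real.exp (∑ i, f i ω)) ≤
      1 / (Fintype.card ι : ℝ) *
        ∑ i, Real.log (∑ ω, w ω * Real.exp ((Fintype.card ι : ℝ) * f i ω)) := by
  set N : ℝ := (Fintype.card ι : ℝ) with hN
  have hN0 : 0 < N := by simp [hN, Fintype.card_pos]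
  have hZ : ∀ i, 0 < ∑ ω, w ω * Real.exp (N * f i ω) := fun i => sum_mul_exp_pos hw hw1 _
  set L : ι → ℝ := fun i => Real.log (∑ ω, w ω * Real.exp (N * f i ω)) with hL
  have hjensen : ∀ ω, Real.exp (∑ i, f i ω) ≤
      Real.exp (1 / N * ∑ i, L i) * ∑ i, 1 / N * Real.exp (N * f i ω - L i) := fun ω => by
    have h := convexOn_exp.map_sum_le (t := Finset.univ) (w := fun _ : ι => 1 / N)
      (p := fun i => N * f i ω - L i) (fun _ _ => by positivity)
      (by simp [← hN, hN0.ne']) (fun _ _ => Set.mem_univ _)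
    simp only [smul_eq_mul] at h
    refine le_trans (le_of_eq ?_) (mul_le_mul_of_nonneg_left h (Real.exp_pos _).le)
    rw [← Real.exp_add, Finset.mul_sum, ← Finset.sum_add_distrib]
    congr 1
    refine Finset.sum_congr rfl fun i _ => ?_
    field_simp
    ring
  have hone : ∀ i, ∑ ω, w ω * Real.exp (N * f i ω - L i) = 1 := fun i => by
    simp only [Real.exp_sub, hL, Real.exp_log (hZ i), ← mul_div_assoc]
    rw [← Finset.sum_div, div_self (hZ i).ne']
  rw [Real.log_le_iff_le_exp (sum_mul_exp_pos hw hw1 _)]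
  calc ∑ ω, w ω * Real.exp (∑ i, f i ω)
      ≤ ∑ ω, w ω *
          (Real.exp (1 / N * ∑ i, L i) * ∑ i, 1 / N * Real.exp (N * f i ω - L i)) :=
        Finset.sum_le_sum fun ω _ => mul_le_mul_of_nonneg_left (hjensen ω) (hw ω)
    _ = Real.exp (1 / N * ∑ i, L i) *
          ∑ i, 1 / N * ∑ ω, w ω * Real.exp (N * f i ω - L i) := by
        simp only [Finset.mul_sum]
        rw [Finset.sum_comm]
        exact Finset.sum_congr rfl fun _ _ => Finset.sum_congr rfl fun _ _ => by ring
    _ = Real.exp (1 / N * ∑ i, L i) := by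
        simp [hone, ← hN, hN0.ne']

/-- The coordinatewise residue class of a lattice point. -/
def residue {d : ℕ} (m : ℕ) (x : Fin d → ℤ) : Fin d → ZMod m := fun i => (x i : ZMod m)

theorem abs_sub_le_l1 {d : ℕ} (x y : Fin d → ℤ) (i : Fin d) : |x i - y i| ≤ l1 x y :=
  Finset.single_le_sum (f := fun i => |x i - y i|) (fun _ _ => abs_nonneg _)
    (Finset.mem_univ i)

/-- Two points in the same residue class modulo `2ℓ+1` whose `ℓ`-balls meet are equal. -/
theorem eq_of_residue_eq {d ℓ : ℕ} {x x' y : Fin d → ℤ}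
    (h : residue (2 * ℓ + 1) x = residue (2 * ℓ + 1) x')
    (hx : l1 y x ≤ ℓ) (hx' : l1 y x' ≤ ℓ) : x = x' := by
  funext i
  have h1 := abs_le.1 ((abs_sub_le_l1 y x i).trans hx)
  have h2 := abs_le.1 ((abs_sub_le_l1 y x' i).trans hx')
  have hd : ((2 * ℓ + 1 : ℕ) : ℤ) ∣ x' i - x i :=
    (ZMod.intCast_eq_intCast_iff_dvd_sub _ _ _).1 (congrFun h i)
  have h0 := Int.eq_zero_of_abs_lt_dvd hd (by rw [abs_lt]; push_cast; omega)
  omega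

/-- **Block decomposition inequality** (proof of Lemma 4.2 of the paper): for a product
measure `ν` on `{0,1}^A`, `A ⊂ ℤ^d` finite, and functions `F_x` depending only on the
coordinates in the ℓ¹-ball of radius `ℓ` around `x`, Hölder's inequality over the residue
classes mod `2ℓ+1` yields
`log E_ν[exp(Σ_x F_x)] ≤ (2ℓ+1)^{-d} Σ_x log E_ν[exp((2ℓ+1)^d F_x)]`. -/
theorem block_holder_inequality
    (d : ℕ) (hd : 1 ≤ d) (ℓ : ℕ)
    (A : Finset (Fin d → ℤ)) (hA : A.Nonempty)
    (p : {x // x ∈ A} → ℝ) (hp : ∀ x, p x ∈ Set.Icc (0 : ℝ) 1)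
    (F : {x // x ∈ A} → ({x // x ∈ A} → Bool) → ℝ)
    (hF_local : ∀ x : {x // x ∈ A}, ∀ η η' : {x // x ∈ A} → Bool,
      (∀ y : {x // x ∈ A}, l1 y.val x.val ≤ (ℓ : ℤ) → η y = η' y) → F x η = F x η') :
    Real.log (∑ η : {x // x ∈ A} → Bool,
        bern p η * Real.exp (∑ x : {x // x ∈ A}, F x η))
      ≤ (1 / ((2 * ℓ + 1 : ℕ) : ℝ) ^ d) * ∑ x : {x // x ∈ A},
          Real.log (∑ η : {x // x ∈ A} → Bool,
            bern p η * Real.exp ((((2 * ℓ + 1 : ℕ) : ℝ) ^ d) * F x η)) := by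
  classical
  have hcard : (((2 * ℓ + 1 : ℕ) : ℝ)) ^ d
      = (Fintype.card (Fin d → ZMod (2 * ℓ + 1)) : ℝ) := by
    simp [ZMod.card]
  rw [hcard]
  set N : ℝ := (Fintype.card (Fin d → ZMod (2 * ℓ + 1)) : ℝ)
  have hw := bern_nonneg hp
  have hw1 := sum_bern p
  let r : {x // x ∈ A} → Fin d → ZMod (2 * ℓ + 1) := fun x => residue (2 * ℓ + 1) x.val
  have hclass : ∀ c, Real.log (∑ η, bern p η * Real.exp (N * ∑ x with r x = c, F x η))
      = ∑ x with r x = c, Real.log (∑ η, bern p η * Real.exp (N * F x η)) := fun c => by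
    rw [← Real.log_prod fun x _ => (sum_mul_exp_pos hw hw1 _).ne',
      ← sum_bern_mul_prod p _ (fun x => {y | l1 y.val x.val ≤ (ℓ : ℤ)})]
    · simp only [Finset.mul_sum, Real.exp_sum]
    · intro x hx x' hx' hne
      refine Set.disjoint_left.2 fun y hy hy' => hne (Subtype.ext ?_)
      refine eq_of_residue_eq ?_ hy hy'
      exact (Finset.mem_filter.1 hx).2.trans (Finset.mem_filter.1 hx').2.symm
    · intro x _ η η' h
      exact congrArg (fun t => Real.exp (N * t)) (hF_local x η η' h)
  have h := log_sum_mul_exp_sum_le hw hw1 fun c η => ∑ x with r x = c, F x η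
  simp only [Finset.sum_fiberwise] at h
  refine h.trans_eq ?_
  rw [Finset.sum_congr rfl fun c _ => hclass c, Finset.sum_fiberwise]

end
end
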